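/- arXiv:1702.00170 — 2 statements merged into one kernel-verified Lean document; each statement's English description precedes it below -/
import Mathlib

section
/- Let k ≥ 1, let a < b be real numbers, let f ∈ C^{2k}[a,b], and let H_{2k−1}(a,b,f;·) be the Hermite interpolation polynomial of degree at most 2k−1 satisfying H^{(j)}(a) = f^{(j)}(a) and H^{(j)}(b) = f^{(j)}(b) for j = 0, 1, …, k−1. Then ∫_a^b |f(x) − H_{2k−1}(a,b,f;x)|² dx ≤ ((b−a)^{4k} / c_k²) ∫_a^b |f^{(2k)}(x)|² dx, where c_k is the Wirtinger–Sobolev constant. -/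
open MeasureTheory Set

/-- The Wirtinger–Sobolev constant `c_k`, defined through its variational
characterization: the infimum of the Rayleigh quotients
`∫₀¹ |u^{(k)}|² / ∫₀¹ |u|²` over nonzero `u ∈ C^k[0,1]` whose derivatives of
order `< k` vanish at both endpoints. -/
noncomputable def wirtingerConst (k : ℕ) : ℝ :=
  sInf { c : ℝ | ∃ u : ℝ → ℂ,
    ContDiffOn ℝ k u (Icc (0:ℝ) 1) ∧
    (∃ x ∈ Icc (0:ℝ) 1, u x ≠ 0) ∧
    (∀ j < k, iteratedDerivWithin j u (Icc (0:ℝ) 1) 0 = 0 ∧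
              iteratedDerivWithin j u (Icc (0:ℝ) 1) 1 = 0) ∧
    c = (∫ x in (0:ℝ)..1, ‖iteratedDerivWithin k u (Icc (0:ℝ) 1) x‖ ^ 2) /
        (∫ x in (0:ℝ)..1, ‖u x‖ ^ 2) }

/-- A `C^n` function on an interval has its iterated derivatives linked by `HasDerivWithinAt`. -/
lemma ContDiffOn.hasDerivWithinAt_iteratedDerivWithin_Icc {a b : ℝ} (hab : a < b) {n : ℕ}
    {f : ℝ → ℂ} (hf : ContDiffOn ℝ n f (Icc a b)) {j : ℕ} (hj : j < n) {x : ℝ}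
    (hx : x ∈ Icc a b) :
    HasDerivWithinAt (iteratedDerivWithin j f (Icc a b))
      (iteratedDerivWithin (j + 1) f (Icc a b) x) (Icc a b) x := by
  rw [iteratedDerivWithin_succ]
  exact ((hf.differentiableOn_iteratedDerivWithin (by exact_mod_cast hj)
    (uniqueDiffOn_Icc hab)) x hx).hasDerivWithinAt

/-- A chain of successive derivatives computes the iterated derivatives within the set. -/
lemma iteratedDerivWithin_eq_of_hasDerivWithinAt {s : Set ℝ} (hs : UniqueDiffOn ℝ s) {n : ℕ}
    {F : ℕ → ℝ → ℂ} (hF : ∀ j < n, ∀ x ∈ s, HasDerivWithinAt (F j) (F (j + 1) x) s x)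
    {j : ℕ} (hj : j ≤ n) : EqOn (iteratedDerivWithin j (F 0) s) (F j) s := by
  induction j with
  | zero => intro x _; simp
  | succ j ih =>
    intro x hx
    rw [iteratedDerivWithin_succ, derivWithin_congr (ih (by omega)) (ih (by omega) hx)]
    exact (hF j hj x hx).derivWithin (hs x hx)

lemma HasDerivWithinAt.hasDerivAt_of_mem_Ioo {a b x : ℝ} {u : ℝ → ℂ} {v : ℂ}
    (h : HasDerivWithinAt u v (Icc a b) x) (hx : x ∈ Ioo a b) : HasDerivAt u v x :=
  h.hasDerivAt (Icc_mem_nhds hx.1 hx.2)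

lemma intervalIntegrable_norm_sq {a b : ℝ} (hab : a ≤ b) {u : ℝ → ℂ}
    (hu : ContinuousOn u (Icc a b)) :
    IntervalIntegrable (fun x => ‖u x‖ ^ 2) volume a b :=
  (hu.norm.pow 2).intervalIntegrable_of_Icc hab

/-- A crude Poincaré inequality on the unit interval. -/
lemma integral_norm_sq_le_integral_norm_deriv_sq {u v : ℝ → ℂ}
    (hu : ∀ x ∈ Icc (0 : ℝ) 1, HasDerivWithinAt u (v x) (Icc 0 1) x)
    (hv : ContinuousOn v (Icc 0 1)) (h0 : u 0 = 0) :
    ∫ x in (0 : ℝ)..1, ‖u x‖ ^ 2 ≤ ∫ x in (0 : ℝ)..1, ‖v x‖ ^ 2 := by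
  have huc : ContinuousOn u (Icc 0 1) := fun x hx => (hu x hx).continuousWithinAt
  have hvn : IntervalIntegrable (fun x => ‖v x‖) volume 0 1 :=
    hv.norm.intervalIntegrable_of_Icc zero_le_one
  have hv2 := intervalIntegrable_norm_sq zero_le_one hv
  set s := ∫ x in (0 : ℝ)..1, ‖v x‖ with hs
  have hs2 : s ^ 2 ≤ ∫ x in (0 : ℝ)..1, ‖v x‖ ^ 2 := by
    have h : ∫ x in (0 : ℝ)..1, (2 * s * ‖v x‖ - s ^ 2) ≤ ∫ x in (0 : ℝ)..1, ‖v x‖ ^ 2 :=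
      intervalIntegral.integral_mono_on zero_le_one
        ((hvn.const_mul _).sub intervalIntegrable_const) hv2
        fun x _ => by nlinarith [sq_nonneg (‖v x‖ - s)]
    rw [intervalIntegral.integral_sub (hvn.const_mul _) intervalIntegrable_const,
      intervalIntegral.integral_const_mul, intervalIntegral.integral_const, ← hs] at h
    simp only [sub_zero, one_smul] at h
    nlinarith
  have hpt : ∀ x ∈ Icc (0 : ℝ) 1, ‖u x‖ ^ 2 ≤ s ^ 2 := by
    intro x hx
    have hsub : Icc 0 x ⊆ Icc (0 : ℝ) 1 := Icc_subset_Icc le_rfl hx.2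
    have hint : ∫ t in (0 : ℝ)..x, v t = u x := by
      rw [intervalIntegral.integral_eq_sub_of_hasDerivAt_of_le hx.1 (huc.mono hsub)
        (fun t ht => (hu t (hsub (Ioo_subset_Icc_self ht))).hasDerivAt_of_mem_Ioo
          ⟨ht.1, ht.2.trans_le hx.2⟩)
        ((hv.mono hsub).intervalIntegrable_of_Icc hx.1), h0, sub_zero]
    have hle : ‖u x‖ ≤ s := by
      rw [← hint]
      refine (intervalIntegral.norm_integral_le_integral_norm hx.1).trans ?_
      exact intervalIntegral.integral_mono_interval le_rfl hx.1 hx.2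
        (Filter.Eventually.of_forall fun t => norm_nonneg _) hvn
    gcongr
  calc ∫ x in (0 : ℝ)..1, ‖u x‖ ^ 2 ≤ ∫ _ in (0 : ℝ)..1, s ^ 2 :=
        intervalIntegral.integral_mono_on zero_le_one
          (intervalIntegrable_norm_sq zero_le_one huc) intervalIntegrable_const hpt
    _ = s ^ 2 := by simp
    _ ≤ _ := hs2

lemma integral_norm_sq_pos {a b : ℝ} (hab : a < b) {u : ℝ → ℂ} (hu : ContinuousOn u (Icc a b))
    (h : ∃ x ∈ Icc a b, u x ≠ 0) : 0 < ∫ x in a..b, ‖u x‖ ^ 2 := by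
  obtain ⟨x, hx, hne⟩ := h
  exact intervalIntegral.integral_pos hab (hu.norm.pow 2) (fun _ _ => by positivity)
    ⟨x, hx, by positivity⟩

/-- Every Rayleigh quotient in the definition of `wirtingerConst` is at least one. -/
lemma integral_norm_sq_le_integral_iteratedDerivWithin {k : ℕ} {u : ℝ → ℂ}
    (hu : ContDiffOn ℝ k u (Icc (0 : ℝ) 1))
    (h0 : ∀ j < k, iteratedDerivWithin j u (Icc (0 : ℝ) 1) 0 = 0) :
    ∫ x in (0 : ℝ)..1, ‖u x‖ ^ 2 ≤
      ∫ x in (0 : ℝ)..1, ‖iteratedDerivWithin k u (Icc (0 : ℝ) 1) x‖ ^ 2 := by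
  have key : ∀ j ≤ k, ∫ x in (0 : ℝ)..1, ‖u x‖ ^ 2 ≤
      ∫ x in (0 : ℝ)..1, ‖iteratedDerivWithin j u (Icc (0 : ℝ) 1) x‖ ^ 2 := by
    intro j
    induction j with
    | zero => intro _; simp
    | succ j ih =>
      intro hj
      exact (ih (by omega)).trans (integral_norm_sq_le_integral_norm_deriv_sq
        (fun x hx => hu.hasDerivWithinAt_iteratedDerivWithin_Icc zero_lt_one hj hx)
        (hu.continuousOn_iteratedDerivWithin (by exact_mod_cast hj)
          (uniqueDiffOn_Icc zero_lt_one)) (h0 j hj))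
  exact key k le_rfl

/-- The constant is positive as soon as there is an admissible function, and it bounds the
`L²` norm of each admissible function. -/
lemma wirtingerConst_pos_and_mul_integral_le {k : ℕ} {u : ℝ → ℂ}
    (hu : ContDiffOn ℝ k u (Icc (0 : ℝ) 1)) (hne : ∃ x ∈ Icc (0 : ℝ) 1, u x ≠ 0)
    (h0 : ∀ j < k, iteratedDerivWithin j u (Icc (0 : ℝ) 1) 0 = 0 ∧
      iteratedDerivWithin j u (Icc (0 : ℝ) 1) 1 = 0) :
    0 < wirtingerConst k ∧
      wirtingerConst k * ∫ x in (0 : ℝ)..1, ‖u x‖ ^ 2 ≤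
        ∫ x in (0 : ℝ)..1, ‖iteratedDerivWithin k u (Icc (0 : ℝ) 1) x‖ ^ 2 := by
  have hlow : ∀ c ∈ { c : ℝ | ∃ u : ℝ → ℂ,
      ContDiffOn ℝ k u (Icc (0:ℝ) 1) ∧
      (∃ x ∈ Icc (0:ℝ) 1, u x ≠ 0) ∧
      (∀ j < k, iteratedDerivWithin j u (Icc (0:ℝ) 1) 0 = 0 ∧
                iteratedDerivWithin j u (Icc (0:ℝ) 1) 1 = 0) ∧
      c = (∫ x in (0:ℝ)..1, ‖iteratedDerivWithin k u (Icc (0:ℝ) 1) x‖ ^ 2) /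
          (∫ x in (0:ℝ)..1, ‖u x‖ ^ 2) }, 1 ≤ c := by
    rintro c ⟨w, hw, hwne, hw0, rfl⟩
    rw [one_le_div (integral_norm_sq_pos zero_lt_one hw.continuousOn hwne)]
    exact integral_norm_sq_le_integral_iteratedDerivWithin hw fun j hj => (hw0 j hj).1
  refine ⟨zero_lt_one.trans_le (le_csInf ⟨_, u, hu, hne, h0, rfl⟩ hlow), ?_⟩
  rw [← le_div_iff₀ (integral_norm_sq_pos zero_lt_one hu.continuousOn hne)]
  exact csInf_le ⟨1, hlow⟩ ⟨u, hu, hne, h0, rfl⟩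

/-- The scaled Wirtinger–Sobolev inequality on `[a, b]`, for a chain of derivatives. -/
lemma wirtingerConst_pos_and_mul_integral_le_of_Icc {a b : ℝ} (hab : a < b) {k : ℕ}
    {G : ℕ → ℝ → ℂ} (hcd : ContDiffOn ℝ k (G 0) (Icc a b))
    (hG : ∀ j < k, ∀ x ∈ Icc a b, HasDerivWithinAt (G j) (G (j + 1) x) (Icc a b) x)
    (hne : ∃ x ∈ Icc a b, G 0 x ≠ 0) (h0 : ∀ j < k, G j a = 0 ∧ G j b = 0) :
    0 < wirtingerConst k ∧
      wirtingerConst k * ∫ x in a..b, ‖G 0 x‖ ^ 2 ≤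
        (b - a) ^ (2 * k) * ∫ x in a..b, ‖G k x‖ ^ 2 := by
  have hL : 0 < b - a := sub_pos.2 hab
  set φ : ℝ → ℝ := fun t => (b - a) * t + a with hφ
  have hmaps : MapsTo φ (Icc 0 1) (Icc a b) := by
    intro t ht
    constructor <;> simp only [hφ] <;> nlinarith [ht.1, ht.2]
  have hφd : ∀ t, HasDerivAt φ (b - a) t := fun t => by
    simpa only [mul_one] using ((hasDerivAt_id' t).const_mul (b - a)).add_const a
  set U : ℕ → ℝ → ℂ := fun j t => ((b - a : ℝ) : ℂ) ^ j * G j (φ t) with hU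
  have hUd : ∀ j < k, ∀ t ∈ Icc (0 : ℝ) 1,
      HasDerivWithinAt (U j) (U (j + 1) t) (Icc 0 1) t := by
    intro j hj t ht
    have h := ((hG j hj _ (hmaps ht)).scomp t (hφd t).hasDerivWithinAt hmaps).const_mul
      (((b - a : ℝ) : ℂ) ^ j)
    refine h.congr_deriv ?_
    simp only [hU, Complex.real_smul]
    ring
  have hit : ∀ j ≤ k, EqOn (iteratedDerivWithin j (U 0) (Icc 0 1)) (U j) (Icc 0 1) :=
    fun j hj => iteratedDerivWithin_eq_of_hasDerivWithinAt (uniqueDiffOn_Icc zero_lt_one) hUd hj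
  have hφ0 : φ 0 = a := by simp [hφ]
  have hφ1 : φ 1 = b := by simp [hφ]
  have hU0 : ContDiffOn ℝ k (U 0) (Icc 0 1) := by
    have : U 0 = G 0 ∘ φ := by ext t; simp [hU]
    rw [this]
    exact hcd.comp (by fun_prop) hmaps
  have hUne : ∃ t ∈ Icc (0 : ℝ) 1, U 0 t ≠ 0 := by
    obtain ⟨x, hx, hx0⟩ := hne
    refine ⟨(x - a) / (b - a), ⟨div_nonneg (by linarith [hx.1]) hL.le,
      (div_le_one hL).2 (by linarith [hx.2])⟩, ?_⟩
    have : φ ((x - a) / (b - a)) = x := by simp only [hφ]; field_simp; ring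
    simpa [hU, this] using hx0
  have hUb : ∀ j < k, iteratedDerivWithin j (U 0) (Icc (0 : ℝ) 1) 0 = 0 ∧
      iteratedDerivWithin j (U 0) (Icc (0 : ℝ) 1) 1 = 0 := by
    intro j hj
    rw [hit j hj.le (left_mem_Icc.2 zero_le_one), hit j hj.le (right_mem_Icc.2 zero_le_one)]
    simp [hU, hφ0, hφ1, h0 j hj]
  obtain ⟨hpos, hle⟩ := wirtingerConst_pos_and_mul_integral_le hU0 hUne hUb
  refine ⟨hpos, ?_⟩
  have hint : ∀ j, ∫ t in (0 : ℝ)..1, ‖U j t‖ ^ 2 =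
      (b - a) ^ (2 * j) * ((b - a)⁻¹ * ∫ x in a..b, ‖G j x‖ ^ 2) := by
    intro j
    have h := intervalIntegral.integral_comp_mul_add (a := 0) (b := 1)
      (fun x => ‖G j x‖ ^ 2) hL.ne' a
    simp only [mul_zero, zero_add, mul_one, sub_add_cancel, smul_eq_mul] at h
    rw [← h, ← intervalIntegral.integral_const_mul]
    refine intervalIntegral.integral_congr fun t _ => ?_
    simp only [hU, hφ, norm_mul, norm_pow, Complex.norm_real, Real.norm_eq_abs, mul_pow,
      abs_of_pos hL]
    ring
  have hk : ∫ t in (0 : ℝ)..1, ‖iteratedDerivWithin k (U 0) (Icc (0 : ℝ) 1) t‖ ^ 2 =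
      ∫ t in (0 : ℝ)..1, ‖U k t‖ ^ 2 := by
    refine intervalIntegral.integral_congr fun t ht => ?_
    rw [uIcc_of_le zero_le_one] at ht
    simp only [hit k le_rfl ht]
  rw [hk, hint, hint] at hle
  have := mul_le_mul_of_nonneg_left hle hL.le
  field_simp at this
  simpa using this

/-- Repeated integration by parts for a chain of derivatives vanishing at the endpoints. -/
lemma integral_norm_sq_le_integral_norm_mul_norm {a b : ℝ} (hab : a < b) {k : ℕ}
    {G : ℕ → ℝ → ℂ}
    (hG : ∀ j < 2 * k, ∀ x ∈ Icc a b, HasDerivWithinAt (G j) (G (j + 1) x) (Icc a b) x)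
    (hc : ∀ j ≤ 2 * k, ContinuousOn (G j) (Icc a b))
    (h0 : ∀ j < k, G j a = 0 ∧ G j b = 0) :
    ∫ x in a..b, ‖G k x‖ ^ 2 ≤ ∫ x in a..b, ‖G 0 x‖ * ‖G (2 * k) x‖ := by
  have key : ∀ m ≤ k, ‖∫ x in a..b, star (G k x) * G k x‖ =
      ‖∫ x in a..b, star (G (k - m) x) * G (k + m) x‖ := by
    intro m
    induction m with
    | zero => intro _; simp
    | succ m ih =>
      intro hm
      rw [ih (by omega)]
      obtain ⟨i, hi⟩ : ∃ i, k = i + (m + 1) := ⟨k - (m + 1), by omega⟩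
      have h1 : k - m = i + 1 := by omega
      have h2 : k - (m + 1) = i := by omega
      rw [h1, h2, ← add_assoc]
      have hu : IntervalIntegrable (fun x => star (G (i + 1) x)) volume a b :=
        (hc _ (by omega)).star.intervalIntegrable_of_Icc hab.le
      have hv : IntervalIntegrable (G (k + m + 1)) volume a b :=
        (hc _ (by omega)).intervalIntegrable_of_Icc hab.le
      have hparts := intervalIntegral.integral_mul_deriv_eq_deriv_mul_of_hasDerivAt
        (u := fun x => star (G i x)) (v := G (k + m))
        (by rw [uIcc_of_le hab.le]; exact (hc _ (by omega)).star)
        (by rw [uIcc_of_le hab.le]; exact hc _ (by omega))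
        (fun x hx => by
          rw [min_eq_left hab.le, max_eq_right hab.le] at hx
          exact ((hG i (by omega) x (Ioo_subset_Icc_self hx)).hasDerivAt_of_mem_Ioo hx).star)
        (fun x hx => by
          rw [min_eq_left hab.le, max_eq_right hab.le] at hx
          exact (hG (k + m) (by omega) x (Ioo_subset_Icc_self hx)).hasDerivAt_of_mem_Ioo hx)
        hu hv
      rw [hparts, (h0 i (by omega)).1, (h0 i (by omega)).2]
      simp
  have hk : ‖∫ x in a..b, star (G k x) * G k x‖ = ∫ x in a..b, ‖G k x‖ ^ 2 := by
    have : ∀ x, star (G k x) * G k x = ((‖G k x‖ ^ 2 : ℝ) : ℂ) := fun x => by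
      rw [mul_comm]
      simpa using Complex.mul_conj' (G k x)
    simp only [this]
    rw [intervalIntegral.integral_ofReal, Complex.norm_real, Real.norm_of_nonneg]
    exact intervalIntegral.integral_nonneg hab.le fun _ _ => by positivity
  rw [← hk, key k le_rfl, Nat.sub_self, ← two_mul]
  refine (intervalIntegral.norm_integral_le_integral_norm hab.le).trans_eq ?_
  simp

/-- The `L²` bound for a chain of `2k` derivatives whose first `k` members vanish at the
endpoints. -/
lemma integral_norm_sq_le_div_wirtingerConst_sq {a b : ℝ} (hab : a < b) {k : ℕ}
    {G : ℕ → ℝ → ℂ} (hcd : ContDiffOn ℝ k (G 0) (Icc a b))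
    (hG : ∀ j < 2 * k, ∀ x ∈ Icc a b, HasDerivWithinAt (G j) (G (j + 1) x) (Icc a b) x)
    (hc : ∀ j ≤ 2 * k, ContinuousOn (G j) (Icc a b))
    (h0 : ∀ j < k, G j a = 0 ∧ G j b = 0) :
    ∫ x in a..b, ‖G 0 x‖ ^ 2 ≤
      (b - a) ^ (4 * k) / (wirtingerConst k) ^ 2 * ∫ x in a..b, ‖G (2 * k) x‖ ^ 2 := by
  have hL : 0 < b - a := sub_pos.2 hab
  by_cases hne : ∃ x ∈ Icc a b, G 0 x ≠ 0
  · obtain ⟨hpos, hle⟩ := wirtingerConst_pos_and_mul_integral_le_of_Icc hab hcd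
      (fun j hj => hG j (by omega)) hne h0
    have hbp := integral_norm_sq_le_integral_norm_mul_norm hab hG hc h0
    have hi0 := intervalIntegrable_norm_sq hab.le (hc 0 (by omega))
    have hi2 := intervalIntegrable_norm_sq hab.le (hc (2 * k) le_rfl)
    set M := (b - a) ^ (2 * k) / wirtingerConst k with hM
    have hM0 : 0 ≤ M := by positivity
    have hA : ∫ x in a..b, ‖G 0 x‖ ^ 2 ≤ M * ∫ x in a..b, ‖G 0 x‖ * ‖G (2 * k) x‖ := by
      refine le_trans ?_ (mul_le_mul_of_nonneg_left hbp hM0)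
      rw [hM, div_mul_eq_mul_div, le_div_iff₀ hpos, mul_comm]
      exact hle
    have hB : M * ∫ x in a..b, ‖G 0 x‖ * ‖G (2 * k) x‖ ≤
        (1 / 2) * (∫ x in a..b, ‖G 0 x‖ ^ 2) +
          (M ^ 2 / 2) * ∫ x in a..b, ‖G (2 * k) x‖ ^ 2 := by
      rw [← intervalIntegral.integral_const_mul, ← intervalIntegral.integral_const_mul,
        ← intervalIntegral.integral_const_mul,
        ← intervalIntegral.integral_add (hi0.const_mul _) (hi2.const_mul _)]
      refine intervalIntegral.integral_mono_on hab.le ?_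
        ((hi0.const_mul _).add (hi2.const_mul _)) fun x _ => ?_
      · exact (((hc 0 (by omega)).norm.mul (hc (2 * k) le_rfl).norm).intervalIntegrable_of_Icc
          hab.le).const_mul _
      · nlinarith [sq_nonneg (‖G 0 x‖ - M * ‖G (2 * k) x‖)]
    have hMsq : (b - a) ^ (4 * k) / (wirtingerConst k) ^ 2 = M ^ 2 := by
      rw [hM, div_pow, ← pow_mul]
      congr 2
      omega
    rw [hMsq]
    linarith
  · push Not at hne
    have hzero : ∫ x in a..b, ‖G 0 x‖ ^ 2 = 0 := by
      rw [intervalIntegral.integral_congr (g := fun _ => (0 : ℝ)), intervalIntegral.integral_zero]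
      intro x hx
      rw [uIcc_of_le hab.le] at hx
      simp [hne x hx]
    rw [hzero]
    have := intervalIntegral.integral_nonneg (μ := volume) (f := fun x => ‖G (2 * k) x‖ ^ 2)
      hab.le fun _ _ => by positivity
    positivity

theorem stmt5 (k : ℕ) (hk : 1 ≤ k) (a b : ℝ) (hab : a < b)
    (f : ℝ → ℂ) (hf : ContDiffOn ℝ (2 * k) f (Icc a b))
    (p : Polynomial ℂ) (hdeg : p.natDegree ≤ 2 * k - 1)
    (hp : ∀ j < k,
      Polynomial.eval ((a : ℂ)) (Polynomial.derivative^[j] p) =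
        iteratedDerivWithin j f (Icc a b) a ∧
      Polynomial.eval ((b : ℂ)) (Polynomial.derivative^[j] p) =
        iteratedDerivWithin j f (Icc a b) b) :
    ∫ x in a..b, ‖f x - Polynomial.eval ((x : ℂ)) p‖ ^ 2 ≤
      (b - a) ^ (4 * k) / (wirtingerConst k) ^ 2 *
        ∫ x in a..b, ‖iteratedDerivWithin (2 * k) f (Icc a b) x‖ ^ 2 := by
  have hf' : ContDiffOn ℝ ((2 * k : ℕ) : WithTop ℕ∞) f (Icc a b) := by exact_mod_cast hf
  have hpc : ∀ q : Polynomial ℂ, ContDiff ℝ k fun x : ℝ => q.eval (x : ℂ) := fun q =>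
    by
    have hq : ContDiff ℂ k fun z : ℂ => q.eval z := by
      simpa using q.contDiff_aeval (𝕜 := ℂ) k
    exact (hq.restrict_scalars ℝ).comp Complex.ofRealCLM.contDiff
  have h := integral_norm_sq_le_div_wirtingerConst_sq hab (k := k)
    (G := fun j x => iteratedDerivWithin j f (Icc a b) x -
      (Polynomial.derivative^[j] p).eval (x : ℂ)) ?_ ?_ ?_ ?_
  · simpa [Polynomial.iterate_derivative_eq_zero (show p.natDegree < 2 * k by omega)] using h
  · simp only [iteratedDerivWithin_zero, Function.iterate_zero, id_eq]
    exact (hf'.of_le (by exact_mod_cast (by omega : k ≤ 2 * k))).sub (hpc p).contDiffOn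
  · intro j hj x hx
    refine (hf'.hasDerivWithinAt_iteratedDerivWithin_Icc hab hj hx).sub ?_
    rw [Function.iterate_succ_apply']
    exact ((Polynomial.derivative^[j] p).hasDerivAt (x : ℂ)).comp_ofReal.hasDerivWithinAt
  · intro j hj
    exact (hf'.continuousOn_iteratedDerivWithin (by exact_mod_cast hj)
      (uniqueDiffOn_Icc hab)).sub (hpc _).continuous.continuousOn
  · intro j hj
    simp [hp j hj]
end

section
/- Let ϑ: ℝ → ℝ be a function which on [0,1] satisfies (P1) 0 ≤ ϑ(w) ≤ 1, (P2) ϑ(w) + ϑ(1−w) = 1, (P3) ϑ is monotonically decreasing, (P4) ϑ(w) = 1 for 0 ≤ w ≤ 1/3, (P5) ϑ(w) ≥ 2 − 3w on [1/3, 1/2] and ϑ(w) ≤ 2 − 3w on [1/2, 2/3], extended by ϑ(w) = ϑ(−w) for −1 ≤ w ≤ 0 and ϑ(w) = 0 for |w| > 1, and let φ(x) = ∫_{−1}^{1} √(ϑ(w)) e^{2πiwx} dw be the associated Meyer scaling function (so that φ̂ = √ϑ and Σ_{l∈ℤ} |φ̂(w+l)|² = 1 a.e.). Then M_2 := esssup_{w∈[0,1]}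 Σ_{l∈ℤ} (w+l)^4 |φ̂(w+l)|² = 1/16. -/
open MeasureTheory FourierTransform Filter Real Set

/-- Properties (P1)–(P5) of the profile function `ϑ` of a Meyer scaling function,
together with its extension (even on `[-1,0]`, vanishing for `|w| > 1`). -/
def MeyerTheta (ϑ : ℝ → ℝ) : Prop :=
  (∀ w ∈ Set.Icc (0:ℝ) 1, 0 ≤ ϑ w ∧ ϑ w ≤ 1) ∧
  (∀ w ∈ Set.Icc (0:ℝ) 1, ϑ w + ϑ (1 - w) = 1) ∧
  AntitoneOn ϑ (Set.Icc (0:ℝ) 1) ∧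
  (∀ w ∈ Set.Icc (0:ℝ) (1/3), ϑ w = 1) ∧
  (∀ w ∈ Set.Icc (1/3 : ℝ) (1/2), 2 - 3 * w ≤ ϑ w) ∧
  (∀ w ∈ Set.Icc (1/2 : ℝ) (2/3), ϑ w ≤ 2 - 3 * w) ∧
  (∀ w ∈ Set.Icc (-1 : ℝ) 0, ϑ w = ϑ (-w)) ∧
  (∀ w : ℝ, 1 < |w| → ϑ w = 0)

/-- On `[0,1]` only the terms `l = 0` and `l = -1` of the periodization survive. -/
theorem MeyerTheta.tsum_eq {ϑ : ℝ → ℝ} (hϑ : MeyerTheta ϑ) {w : ℝ} (hw : w ∈ Icc (0:ℝ) 1) :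
    ∑' l : ℤ, (w + (l : ℝ)) ^ 4 * √(ϑ (w + l)) ^ 2 =
      w ^ 4 * ϑ w + (1 - w) ^ 4 * (1 - ϑ w) := by
  obtain ⟨h01, hsum, -, hone, -, -, heven, hzero⟩ := hϑ
  obtain ⟨hw0, hw1⟩ := hw
  have hϑ1 : ϑ 1 = 0 := by
    have h1 := hsum 0 (by norm_num)
    rw [hone 0 (by norm_num)] at h1
    norm_num at h1
    exact h1
  have hϑ1' : ϑ (-1) = 0 := by
    rw [heven (-1) (by norm_num), neg_neg, hϑ1]
  have hvanish : ∀ x : ℝ, 1 ≤ |x| → ϑ x = 0 := by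
    intro x hx
    rcases hx.lt_or_eq with hx | hx
    · exact hzero x hx
    · rcases eq_or_eq_neg_of_abs_eq hx.symm with rfl | rfl
      exacts [hϑ1, hϑ1']
  have hshift : ϑ (w + -1) = 1 - ϑ w := by
    have h1 := heven (w + -1) ⟨by linarith, by linarith⟩
    have h2 := hsum w ⟨hw0, hw1⟩
    rw [show -(w + -1) = 1 - w by ring] at h1
    linarith
  rw [tsum_eq_sum (s := {0, -1})]
  · rw [Finset.sum_pair (by norm_num)]
    have h1 := h01 w ⟨hw0, hw1⟩
    push_cast
    rw [hshift, add_zero, Real.sq_sqrt h1.1, Real.sq_sqrt (by linarith [h1.2])]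
    ring
  · intro l hl
    simp only [Finset.mem_insert, Finset.mem_singleton, not_or] at hl
    have hl' : (1:ℤ) ≤ l ∨ l ≤ -2 := by omega
    rw [hvanish, Real.sqrt_zero]
    · simp
    · rcases hl' with h | h
      · have : (1:ℝ) ≤ l := by exact_mod_cast h
        exact le_abs.2 (Or.inl (by linarith))
      · have : (l:ℝ) ≤ -2 := by exact_mod_cast h
        exact le_abs.2 (Or.inr (by linarith))

theorem one_sub_pow_four_sub_pow_four_nonneg {w : ℝ} (hw : w ≤ 1 / 2) :
    0 ≤ (1 - w) ^ 4 - w ^ 4 := by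
  have h : (1 - w) ^ 4 - w ^ 4 = (1 - 2 * w) * ((1 - w) ^ 2 + w ^ 2) := by ring
  rw [h]
  have : 0 ≤ 1 - 2 * w := by linarith
  positivity

theorem MeyerTheta.moment_le_of_le_half {ϑ : ℝ → ℝ} (hϑ : MeyerTheta ϑ) {w : ℝ} (hw0 : 0 ≤ w)
    (hw : w ≤ 1 / 2) : w ^ 4 * ϑ w + (1 - w) ^ 4 * (1 - ϑ w) ≤ 1 / 16 := by
  obtain ⟨-, -, -, hone, hlow, -⟩ := hϑ
  rcases le_total w (1 / 3) with h | h
  · rw [hone w ⟨hw0, h⟩]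
    have : w ^ 4 ≤ (1 / 3) ^ 4 := by gcongr
    linarith
  · have h1 := mul_nonneg (one_sub_pow_four_sub_pow_four_nonneg hw)
      (sub_nonneg.2 (hlow w ⟨h, hw⟩))
    have h2 : 1 / 16 - (w ^ 4 * (2 - 3 * w) + (1 - w) ^ 4 * (3 * w - 1)) =
        3 / 2 * (1 / 2 - w) ^ 2 + 11 * (1 / 2 - w) ^ 4 := by ring
    have h3 : 0 ≤ 3 / 2 * (1 / 2 - w) ^ 2 + 11 * (1 / 2 - w) ^ 4 := by positivity
    linarith

theorem MeyerTheta.moment_le {ϑ : ℝ → ℝ} (hϑ : MeyerTheta ϑ) {w : ℝ} (hw : w ∈ Icc (0:ℝ) 1) :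
    w ^ 4 * ϑ w + (1 - w) ^ 4 * (1 - ϑ w) ≤ 1 / 16 := by
  rcases le_total w (1 / 2) with h | h
  · exact hϑ.moment_le_of_le_half hw.1 h
  · have h1 := hϑ.moment_le_of_le_half (w := 1 - w) (by linarith [hw.2]) (by linarith)
    rw [show ϑ (1 - w) = 1 - ϑ w by linarith [hϑ.2.1 w hw]] at h1
    linarith

theorem MeyerTheta.pow_four_le_moment {ϑ : ℝ → ℝ} (hϑ : MeyerTheta ϑ) {w : ℝ} (hw0 : 0 ≤ w)
    (hw : w ≤ 1 / 2) : w ^ 4 ≤ w ^ 4 * ϑ w + (1 - w) ^ 4 * (1 - ϑ w) := by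
  have h1 := mul_nonneg (one_sub_pow_four_sub_pow_four_nonneg hw)
    (sub_nonneg.2 (hϑ.1 w ⟨hw0, by linarith⟩).2)
  linarith

theorem stmt16 (ϑ : ℝ → ℝ) (hϑ : MeyerTheta ϑ)
    (φ : ℝ → ℂ)
    (hφ : ∀ x : ℝ, φ x = ∫ w in (-1 : ℝ)..1,
      (Real.sqrt (ϑ w) : ℂ) * Complex.exp (2 * Real.pi * Complex.I * w * x))
    (hFourier : ∀ w : ℝ, 𝓕 φ w = (Real.sqrt (ϑ w) : ℂ))
    (hortho : ∀ᵐ w : ℝ, ∑' l : ℤ, ‖𝓕 φ (w + l)‖ ^ 2 = 1) :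
    essSup (fun w : ℝ => ENNReal.ofReal
        (∑' l : ℤ, (w + (l : ℝ)) ^ 4 * ‖𝓕 φ (w + l)‖ ^ 2))
      (volume.restrict (Icc (0:ℝ) 1)) = ENNReal.ofReal (1/16) := by
  have hmoment : ∀ w ∈ Icc (0:ℝ) 1, ∑' l : ℤ, (w + (l : ℝ)) ^ 4 * ‖𝓕 φ (w + l)‖ ^ 2 =
      w ^ 4 * ϑ w + (1 - w) ^ 4 * (1 - ϑ w) := by
    intro w hw
    rw [← hϑ.tsum_eq hw]
    simp_rw [hFourier, Complex.norm_real, Real.norm_eq_abs, sq_abs]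
  apply le_antisymm
  · refine essSup_le_of_ae_le _ ?_
    filter_upwards [ae_restrict_mem measurableSet_Icc] with w hw
    rw [hmoment w hw]
    exact ENNReal.ofReal_le_ofReal (hϑ.moment_le hw)
  · set M := essSup (fun w : ℝ => ENNReal.ofReal
        (∑' l : ℤ, (w + (l : ℝ)) ^ 4 * ‖𝓕 φ (w + l)‖ ^ 2)) (volume.restrict (Icc (0:ℝ) 1))
    have hae : ∀ᵐ w ∂(volume.restrict (Icc (0:ℝ) 1)), ENNReal.ofReal
        (∑' l : ℤ, (w + (l : ℝ)) ^ 4 * ‖𝓕 φ (w + l)‖ ^ 2) ≤ M := ENNReal.ae_le_essSup _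
    rw [ae_restrict_iff' measurableSet_Icc] at hae
    have hbound : ∀ a ∈ Ioo (0:ℝ) (1 / 2), ENNReal.ofReal (a ^ 4) ≤ M := by
      rintro a ⟨ha0, ha⟩
      obtain ⟨w, ⟨haw, hw⟩, hwM⟩ := (Measure.dense_of_ae hae).inter_open_nonempty _ isOpen_Ioo
        (nonempty_Ioo.2 ha)
      have hw01 : w ∈ Icc (0:ℝ) 1 := ⟨by linarith, by linarith⟩
      refine le_trans ?_ (hwM hw01)
      rw [hmoment w hw01]
      exact ENNReal.ofReal_le_ofReal
        ((by gcongr : a ^ 4 ≤ w ^ 4).trans (hϑ.pow_four_le_moment hw01.1 hw.le))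
    have hlim : Tendsto (fun a : ℝ => ENNReal.ofReal (a ^ 4)) (nhdsWithin (1 / 2) (Iio (1 / 2)))
        (nhds (ENNReal.ofReal ((1 / 2) ^ 4))) :=
      (ENNReal.continuous_ofReal.comp (continuous_pow 4)).continuousAt.tendsto.mono_left
        nhdsWithin_le_nhds
    rw [show (1 / 16 : ℝ) = (1 / 2) ^ 4 by norm_num]
    refine le_of_tendsto hlim ?_
    filter_upwards [Ioo_mem_nhdsLT (show (0:ℝ) < 1 / 2 by norm_num)] with a ha
    exact hbound a ha
end
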